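/- For all A, A' ∈ B^{m,i} and every l ∈ {1,…,n}: f_l A = A' if and only if e_l A' = A. -/

import Mathlib

open Finset

namespace KR

/-- Arrays of integers indexed by (column, row). -/
abbrev Arr := ℕ → ℕ → ℤ

/-- A Dyck path from (1,i) to (i,n). -/
def IsDyck (n i : ℕ) (L : List (ℕ × ℕ)) : Prop :=
  L ≠ [] ∧ L.head? = some (1, i) ∧ L.getLast? = some (i, n) ∧
    L.Chain' (fun β γ => γ = (β.1, β.2 + 1) ∨ γ = (β.1 + 1, β.2))

/-- Membership in the polytope `B^{m,i}`: nonnegative entries supported on the box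
`1 ≤ p ≤ i`, `i ≤ q ≤ n`, with all Dyck path sums bounded by `m`. -/
def InB (n i m : ℕ) (A : Arr) : Prop :=
  (∀ p q, 1 ≤ p → p ≤ i → i ≤ q → q ≤ n → 0 ≤ A p q) ∧
  (∀ p q, ¬(1 ≤ p ∧ p ≤ i ∧ i ≤ q ∧ q ≤ n) → A p q = 0) ∧
  (∀ L, IsDyck n i L → (L.map fun β => A β.1 β.2).sum ≤ (m : ℤ))

/-- The sum `Σ_{j=1}^{p} a_{j,l−1} + Σ_{j=p}^{i} a_{j,l}` (used for `l > i`). -/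
def Fp (i : ℕ) (A : Arr) (l p : ℕ) : ℤ :=
  ∑ j ∈ Icc 1 p, A j (l - 1) + ∑ j ∈ Icc p i, A j l

/-- `p_+^l(A)`: minimal maximizer of `Fp` on `{1,…,i}`. -/
noncomputable def pplus (i : ℕ) (A : Arr) (l : ℕ) : ℕ :=
  sInf {p | p ∈ Icc 1 i ∧ ∀ q ∈ Icc 1 i, Fp i A l q ≤ Fp i A l p}

/-- `q_+^l(A)`: maximal maximizer of `Fp` on `{1,…,i}`. -/
noncomputable def qplus (i : ℕ) (A : Arr) (l : ℕ) : ℕ :=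
  sSup {p | p ∈ Icc 1 i ∧ ∀ q ∈ Icc 1 i, Fp i A l q ≤ Fp i A l p}

/-- The sum `Σ_{j=i}^{p} a_{l,j} + Σ_{j=p}^{n} a_{l+1,j}` (used for `l < i`). -/
def Fm (n i : ℕ) (A : Arr) (l p : ℕ) : ℤ :=
  ∑ j ∈ Icc i p, A l j + ∑ j ∈ Icc p n, A (l + 1) j

/-- `p_−^l(A)`: maximal maximizer of `Fm` on `{i,…,n}`. -/
noncomputable def pminus (n i : ℕ) (A : Arr) (l : ℕ) : ℕ :=
  sSup {p | p ∈ Icc i n ∧ ∀ q ∈ Icc i n, Fm n i A l q ≤ Fm n i A l p}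

/-- `q_−^l(A)`: minimal maximizer of `Fm` on `{i,…,n}`. -/
noncomputable def qminus (n i : ℕ) (A : Arr) (l : ℕ) : ℕ :=
  sInf {p | p ∈ Icc i n ∧ ∀ q ∈ Icc i n, Fm n i A l q ≤ Fm n i A l p}

/-- `φ_l(A)` (depending on the parameter `m` only when `l = i`). -/
noncomputable def phi (n i m : ℕ) (l : ℕ) (A : Arr) : ℤ :=
  if l = i then (m : ℤ) - ∑ j ∈ Icc 1 (i - 1), A j i - ∑ j ∈ Icc i n, A i j
  else if i < l then
    ∑ j ∈ Icc 1 (pplus i A l), A j (l - 1) - ∑ j ∈ Icc 1 (pplus i A l - 1), A j l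
  else
    ∑ j ∈ Icc (pminus n i A l) n, A (l + 1) j - ∑ j ∈ Icc (pminus n i A l + 1) n, A l j

/-- `ε_l(A)` (the parameter `m` is carried along for uniformity; it is not used). -/
noncomputable def eps (n i m : ℕ) (l : ℕ) (A : Arr) : ℤ :=
  if l = i then A i i
  else if i < l then
    ∑ j ∈ Icc (qplus i A l) i, A j l - ∑ j ∈ Icc (qplus i A l + 1) i, A j (l - 1)
  else
    ∑ j ∈ Icc i (qminus n i A l), A l j - ∑ j ∈ Icc i (qminus n i A l - 1), A (l + 1) j

/-- Update a single entry of an array. -/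
def upd (A : Arr) (p q : ℕ) (v : ℤ) : Arr :=
  fun p' q' => if p' = p ∧ q' = q then v else A p' q'

/-- The Kashiwara operator `f_l` (with `none` playing the role of `0`). -/
noncomputable def fop (n i m : ℕ) (l : ℕ) (A : Arr) : Option Arr :=
  if phi n i m l A = 0 then none
  else some <|
    if l = i then upd A i i (A i i + 1)
    else if i < l then
      upd (upd A (pplus i A l) (l - 1) (A (pplus i A l) (l - 1) - 1))
        (pplus i A l) l (A (pplus i A l) l + 1)
    else
      upd (upd A l (pminus n i A l) (A l (pminus n i A l) + 1))
        (l + 1) (pminus n i A l) (A (l + 1) (pminus n i A l) - 1)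

/-- The Kashiwara operator `e_l` (with `none` playing the role of `0`). -/
noncomputable def eop (n i m : ℕ) (l : ℕ) (A : Arr) : Option Arr :=
  if eps n i m l A = 0 then none
  else some <|
    if l = i then upd A i i (A i i - 1)
    else if i < l then
      upd (upd A (qplus i A l) (l - 1) (A (qplus i A l) (l - 1) + 1))
        (qplus i A l) l (A (qplus i A l) l - 1)
    else
      upd (upd A l (qminus n i A l) (A l (qminus n i A l) - 1))
        (l + 1) (qminus n i A l) (A (l + 1) (qminus n i A l) + 1)

/-- Coefficient of `ω_j` in the simple root `α_r` (column `r` of the Cartan matrix). -/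
def cart (j r : ℕ) : ℤ :=
  if r = j then 2 else if r = j + 1 ∨ j = r + 1 then -1 else 0

/-- The weight `wt(A) = mω_i − Σ a_{p,q} α_{p,q}`, expressed in the basis of
fundamental weights: `wtv n i m A j` is the coefficient of `ω_j`. -/
def wtv (n i m : ℕ) (A : Arr) (j : ℕ) : ℤ :=
  (m : ℤ) * (if j = i then 1 else 0) -
    ∑ p ∈ Icc 1 i, ∑ q ∈ Icc i n, A p q * ∑ r ∈ Icc p q, cart j r

/-- The coefficient `c_l(p,q)` of the pairing `⟨α_l^∨, α_{p,q}⟩`. -/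
def clpq (l p q : ℕ) : ℤ :=
  if p = l ∧ q = l then 2
  else if (l = p ∧ p < q) ∨ (p < q ∧ q = l) then 1
  else if l + 1 = p ∨ l = q + 1 then -1
  else 0

/-- The pairing `⟨α_l^∨, wt(A)⟩ = m·δ_{l,i} − Σ_{p,q} a_{p,q}·c_l(p,q)`. -/
def pairing (n i m : ℕ) (l : ℕ) (A : Arr) : ℤ :=
  (m : ℤ) * (if l = i then 1 else 0) -
    ∑ p ∈ Icc 1 i, ∑ q ∈ Icc i n, A p q * clpq l p q

/-! ### The promotion algorithm -/

/-- Columns, indexed by rows `i,…,n`. -/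
abbrev Col := ℕ → ℤ

/-- `Σ_{j=lo}^{p} a_j + Σ_{j=p}^{n} b_j`. -/
def Gc (n lo : ℕ) (a b : Col) (p : ℕ) : ℤ := ∑ j ∈ Icc lo p, a j + ∑ j ∈ Icc p n, b j

/-- `q_−` for two (truncated) columns with rows `lo,…,n`: the minimal maximizer of `Gc`. -/
noncomputable def qmc (n lo : ℕ) (a b : Col) : ℕ :=
  if lo ≤ n then
    max lo (sInf {p | p ∈ Icc lo n ∧ ∀ q ∈ Icc lo n, Gc n lo a b q ≤ Gc n lo a b p})
  else n

/-- `ε` for two (truncated) columns with rows `lo,…,n`. -/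
noncomputable def epsc (n lo : ℕ) (a b : Col) : ℤ :=
  ∑ j ∈ Icc lo (qmc n lo a b), a j - ∑ j ∈ Icc lo (qmc n lo a b - 1), b j

/-- The sequence `l_1 < l_2 < ⋯` of the promotion algorithm:
`l_1 = q_−(a,c)` and `l_{s+1} = q_−((a)^{≥ l_s + 1}, (c)^{≥ l_s + 1})`,
stabilizing at `n`. -/
noncomputable def lfun (n i : ℕ) (a c : Col) : ℕ → ℕ
  | 0 => qmc n i a c
  | s + 1 => qmc n (lfun n i a c s + 1) a c

/-- The set `{l_1, …, l_t}` (with `l_t = n`). -/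
noncomputable def lset (n i : ℕ) (a c : Col) : Finset ℕ := (Finset.range (n + 1)).image (lfun n i a c)

/-- The new column `ĉ` of formula (6.2). -/
noncomputable def hatc (n i : ℕ) (a c : Col) : Col := fun r =>
  if r = n then a n + c n
  else if r ∈ lset n i a c then a r + c r - epsc n (r + 1) a c
  else a r

/-- The output column of one step of the promotion algorithm. -/
noncomputable def prcol (n i : ℕ) (a c : Col) : Col := fun r =>
  if r = i then epsc n i a c
  else if r - 1 ∈ lset n i a c then epsc n r a c
  else c (r - 1)

/-- The running columns of the promotion algorithm: `cseq 0` is the `i`-th column of `A`,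
and `cseq (k+1)` is obtained from the `(i−1−k)`-th column of `A` and `cseq k`. -/
noncomputable def cseq (n i : ℕ) (A : Arr) : ℕ → Col
  | 0 => fun r => A i r
  | k + 1 => hatc n i (fun r => A (i - 1 - k) r) (cseq n i A k)

/-- The `j`-th column of `pr(A)` for `2 ≤ j ≤ i`. -/
noncomputable def prColJ (n i : ℕ) (A : Arr) (j : ℕ) : Col :=
  prcol n i (fun q => A (j - 1) q) (cseq n i A (i - j))

/-- The promotion map `pr` on `B^{m,i}`. -/
noncomputable def prMap (n i m : ℕ) (A : Arr) : Arr := fun p r =>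
  if 1 ≤ p ∧ p ≤ i ∧ i ≤ r ∧ r ≤ n then
    if p = 1 then
      if r = i then
        (m : ℤ) - (∑ j ∈ Icc i n, A i j) - ∑ j ∈ Icc 2 i, prColJ n i A j i
      else
        (∑ j ∈ Icc 1 i, A j (r - 1)) - ∑ j ∈ Icc 2 i, prColJ n i A j r
    else prColJ n i A p r
  else 0

/-- The content `(r_1,…,r_{n+1})` of an array. -/
def cont (n i m : ℕ) (A : Arr) (k : ℕ) : ℤ :=
  if k ≤ i then (m : ℤ) - ∑ q ∈ Icc i n, A k q else ∑ p ∈ Icc 1 i, A p (k - 1)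

/-- The set of maximizers of `F` on `{lo,…,hi}`. -/
def maximizers (lo hi : ℕ) (F : ℕ → ℤ) : Set ℕ :=
  {p | p ∈ Icc lo hi ∧ ∀ q ∈ Icc lo hi, F q ≤ F p}

lemma maximizers_nonempty {lo hi : ℕ} (h : lo ≤ hi) (F : ℕ → ℤ) :
    (maximizers lo hi F).Nonempty := by
  obtain ⟨p, hp, hmax⟩ := exists_max_image (Icc lo hi) F ⟨lo, by simp [h]⟩
  exact ⟨p, hp, hmax⟩

lemma maximizers_bddAbove (lo hi : ℕ) (F : ℕ → ℤ) : BddAbove (maximizers lo hi F) :=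
  ⟨hi, fun _ hp => (mem_Icc.1 hp.1).2⟩

/-- The minimal maximizer strictly beats everything before it. -/
lemma sInf_maximizers_eq_iff {lo hi : ℕ} (h : lo ≤ hi) {F : ℕ → ℤ} {p : ℕ} :
    sInf (maximizers lo hi F) = p ↔
      p ∈ maximizers lo hi F ∧ ∀ q ∈ Icc lo hi, q < p → F q < F p := by
  constructor
  · rintro rfl
    have hp := Nat.sInf_mem (maximizers_nonempty h F)
    refine ⟨hp, fun q hq hlt => lt_of_not_ge fun hge => ?_⟩
    exact Nat.notMem_of_lt_sInf hlt ⟨hq, fun r hr => (hp.2 r hr).trans hge⟩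
  · rintro ⟨hp, hlt⟩
    refine le_antisymm (Nat.sInf_le hp) (le_of_not_gt fun hcon => ?_)
    have hs := Nat.sInf_mem (maximizers_nonempty h F)
    exact absurd (hlt _ hs.1 hcon) (not_lt.2 (hs.2 _ hp.1))

/-- The maximal maximizer strictly beats everything after it. -/
lemma sSup_maximizers_eq_iff {lo hi : ℕ} (h : lo ≤ hi) {F : ℕ → ℤ} {p : ℕ} :
    sSup (maximizers lo hi F) = p ↔
      p ∈ maximizers lo hi F ∧ ∀ q ∈ Icc lo hi, p < q → F q < F p := by
  have hb := maximizers_bddAbove lo hi F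
  have hs := Nat.sSup_mem (maximizers_nonempty h F) hb
  constructor
  · rintro rfl
    refine ⟨hs, fun q hq hlt => lt_of_not_ge fun hge => ?_⟩
    exact absurd (le_csSup hb ⟨hq, fun r hr => (hs.2 r hr).trans hge⟩) (not_le.2 hlt)
  · rintro ⟨hp, hlt⟩
    refine le_antisymm (le_of_not_gt fun hcon => ?_) (le_csSup hb hp)
    exact absurd (hlt _ hs.1 hcon) (not_lt.2 (hs.2 _ hp.1))

lemma Gc_transfer {lo hi p q : ℕ} {x y x' y' : Col} (hp : p ∈ Icc lo hi)
    (hx : ∀ j, x' j = x j - if j = p then 1 else 0)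
    (hy : ∀ j, y' j = y j + if j = p then 1 else 0) :
    Gc hi lo x' y' q =
      Gc hi lo x y q - (if p ≤ q then 1 else 0) + (if q ≤ p then 1 else 0) := by
  rw [mem_Icc] at hp
  simp only [Gc, hx, hy, sum_sub_distrib, sum_add_distrib, sum_ite_eq', mem_Icc, hp, and_true,
    true_and]
  ring

lemma Gc_eq_sum_add_tail {lo hi p : ℕ} (x y : Col) (hp : p ∈ Icc lo hi) :
    Gc hi lo x y p =
      ∑ j ∈ Icc lo hi, x j + (∑ j ∈ Icc p hi, y j - ∑ j ∈ Icc (p + 1) hi, x j) := by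
  rw [mem_Icc] at hp
  have hu : Icc lo hi = Icc lo p ∪ Icc (p + 1) hi := by ext j; simp; omega
  have hd : Disjoint (Icc lo p) (Icc (p + 1) hi) := by
    rw [disjoint_left]; intro j; simp; omega
  rw [Gc, hu, sum_union hd]
  ring

lemma Gc_eq_head_add_sum {lo hi p : ℕ} (x y : Col) (hlo : 1 ≤ lo) (hp : p ∈ Icc lo hi) :
    Gc hi lo x y p =
      (∑ j ∈ Icc lo p, x j - ∑ j ∈ Icc lo (p - 1), y j) + ∑ j ∈ Icc lo hi, y j := by
  rw [mem_Icc] at hp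
  have hu : Icc lo hi = Icc lo (p - 1) ∪ Icc p hi := by ext j; simp; omega
  have hd : Disjoint (Icc lo (p - 1)) (Icc p hi) := by
    rw [disjoint_left]; intro j; simp; omega
  rw [Gc, hu, sum_union hd]
  ring

/-- Moving a unit from `x` to `y` at the minimal maximizer `p` makes `p` the maximal maximizer. -/
lemma sSup_maximizers_Gc {lo hi p : ℕ} (h : lo ≤ hi) {x y x' y' : Col}
    (hpos : ∀ j ∈ Icc lo hi, 0 ≤ y j)
    (hp : sInf (maximizers lo hi (Gc hi lo x y)) = p)
    (hx : ∀ j, x' j = x j - if j = p then 1 else 0)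
    (hy : ∀ j, y' j = y j + if j = p then 1 else 0) :
    sSup (maximizers lo hi (Gc hi lo x' y')) = p ∧
      ∑ j ∈ Icc p hi, y' j - ∑ j ∈ Icc (p + 1) hi, x' j ≠ 0 := by
  obtain ⟨⟨hpm, hmax⟩, hlt⟩ := (sInf_maximizers_eq_iff h).1 hp
  have key := fun q => Gc_transfer (q := q) hpm hx hy
  have hgt : ∀ q ∈ Icc lo hi, p < q → Gc hi lo x' y' q < Gc hi lo x' y' p := by
    intro q hq hpq
    have := hmax q hq
    rw [key q, key p]
    simp [hpq.le, hpq.not_ge]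
    omega
  refine ⟨(sSup_maximizers_eq_iff h).2 ⟨⟨hpm, fun q hq => ?_⟩, hgt⟩, ?_⟩
  · rcases lt_trichotomy q p with hqp | rfl | hqp
    · have := hlt q hq hqp
      rw [key q, key p]
      simp [hqp.le, hqp.not_ge]
      omega
    · exact le_rfl
    · exact (hgt q hq hqp).le
  · have hhi : hi ∈ Icc lo hi := by simp [h]
    rcases eq_or_ne p hi with rfl | hne
    · have := hpos p hpm
      simp [hy]
      omega
    · have hph : p < hi := lt_of_le_of_ne (mem_Icc.1 hpm).2 hne
      have h1 := hgt hi hhi hph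
      rw [Gc_eq_sum_add_tail x' y' hpm, Gc_eq_sum_add_tail x' y' hhi] at h1
      have h2 : y' hi = y hi := by simp [hy, hne.symm]
      have h3 := hpos hi hhi
      simp [h2] at h1
      omega

/-- Moving a unit from `y'` to `x'` at the maximal maximizer `p` makes `p` the minimal
maximizer. -/
lemma sInf_maximizers_Gc {lo hi p : ℕ} (hlo : 1 ≤ lo) (h : lo ≤ hi) {x y x' y' : Col}
    (hpos : ∀ j ∈ Icc lo hi, 0 ≤ x' j)
    (hp : sSup (maximizers lo hi (Gc hi lo x' y')) = p)
    (hx : ∀ j, x' j = x j - if j = p then 1 else 0)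
    (hy : ∀ j, y' j = y j + if j = p then 1 else 0) :
    sInf (maximizers lo hi (Gc hi lo x y)) = p ∧
      ∑ j ∈ Icc lo p, x j - ∑ j ∈ Icc lo (p - 1), y j ≠ 0 := by
  obtain ⟨⟨hpm, hmax⟩, hlt⟩ := (sSup_maximizers_eq_iff h).1 hp
  have key := fun q => Gc_transfer (q := q) hpm hx hy
  have hgt : ∀ q ∈ Icc lo hi, q < p → Gc hi lo x y q < Gc hi lo x y p := by
    intro q hq hpq
    have := hmax q hq
    rw [key q, key p] at this
    simp [hpq.le, hpq.not_ge] at this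
    omega
  refine ⟨(sInf_maximizers_eq_iff h).2 ⟨⟨hpm, fun q hq => ?_⟩, hgt⟩, ?_⟩
  · rcases lt_trichotomy q p with hqp | rfl | hqp
    · exact (hgt q hq hqp).le
    · exact le_rfl
    · have := hlt q hq hqp
      rw [key q, key p] at this
      simp [hqp.le, hqp.not_ge] at this
      omega
  · have hl : lo ∈ Icc lo hi := by simp [h]
    have hx' : ∀ j, x j = x' j + if j = p then 1 else 0 := fun j => by rw [hx]; ring
    rcases eq_or_ne p lo with rfl | hne
    · have := hpos p hpm
      have he : Icc p (p - 1) = ∅ := Icc_eq_empty (by omega)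
      simp [hx', he]
      omega
    · have hph : lo < p := lt_of_le_of_ne (mem_Icc.1 hpm).1 hne.symm
      have h1 := hgt lo hl hph
      rw [Gc_eq_head_add_sum x y hlo hpm, Gc_eq_head_add_sum x y hlo hl] at h1
      have h2 : x lo = x' lo := by simp [hx', hne.symm]
      have h3 := hpos lo hl
      have he : Icc lo (lo - 1) = ∅ := Icc_eq_empty (by omega)
      simp [h2, he] at h1
      omega

/-- There is a partial Dyck path from `(1,i)` to `b` whose `A`-sum is `s`. -/
def Reaches (i : ℕ) (A : Arr) (b : ℕ × ℕ) (s : ℤ) : Prop :=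
  ∃ L : List (ℕ × ℕ), L.head? = some (1, i) ∧ L.getLast? = some b ∧
    L.IsChain (fun β γ => γ = (β.1, β.2 + 1) ∨ γ = (β.1 + 1, β.2)) ∧
    (L.map fun β => A β.1 β.2).sum = s

lemma Reaches.step {i : ℕ} {A : Arr} {b : ℕ × ℕ} {s : ℤ} (h : Reaches i A b s) (c : ℕ × ℕ)
    (hc : c = (b.1, b.2 + 1) ∨ c = (b.1 + 1, b.2)) : Reaches i A c (s + A c.1 c.2) := by
  obtain ⟨L, hh, hl, hch, hs⟩ := h
  refine ⟨L ++ [c], by simp [hh], by simp, ?_, by simp [hs]⟩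
  rw [List.isChain_append]
  refine ⟨hch, List.isChain_singleton c, ?_⟩
  simpa [hl] using hc

lemma reaches_row (i : ℕ) (A : Arr) (p : ℕ) (hp : 1 ≤ p) :
    Reaches i A (p, i) (∑ j ∈ Icc 1 p, A j i) := by
  induction p, hp using Nat.le_induction with
  | base => exact ⟨[(1, i)], by simp⟩
  | succ p hp ih =>
    rw [sum_Icc_succ_top (by omega)]
    exact ih.step (p + 1, i) (Or.inr rfl)

lemma reaches_col {i : ℕ} (A : Arr) (hi : 1 ≤ i) (q : ℕ) (hq : i ≤ q) :
    Reaches i A (i, q) (∑ j ∈ Icc 1 (i - 1), A j i + ∑ j ∈ Icc i q, A i j) := by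
  induction q, hq using Nat.le_induction with
  | base =>
    have h := reaches_row i A i hi
    obtain ⟨k, rfl⟩ : ∃ k, i = k + 1 := ⟨i - 1, by omega⟩
    rw [sum_Icc_succ_top (by omega)] at h
    simpa using h
  | succ q hq ih =>
    rw [sum_Icc_succ_top (by omega), ← add_assoc]
    exact ih.step (i, q + 1) (Or.inl rfl)

lemma InB.phi_self_nonneg {n i m : ℕ} {A : Arr} (hA : InB n i m A) (hi : 1 ≤ i) (hin : i ≤ n) :
    0 ≤ phi n i m i A := by
  obtain ⟨L, hh, hl, hch, hs⟩ := reaches_col A hi n hin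
  have := hA.2.2 L ⟨by rintro rfl; simp at hh, hh, hl, hch⟩
  simp only [phi, if_true]
  omega

lemma phi_self_upd {n i m : ℕ} (A : Arr) (hi : 1 ≤ i) (hin : i ≤ n) (v : ℤ) :
    phi n i m i (upd A i i v) = phi n i m i A + A i i - v := by
  have h1 : ∑ j ∈ Icc 1 (i - 1), upd A i i v j i = ∑ j ∈ Icc 1 (i - 1), A j i := by
    refine sum_congr rfl fun j hj => ?_
    have : j ≠ i := by rw [mem_Icc] at hj; omega
    simp [upd, this]
  have h2 : ∑ j ∈ Icc i n, upd A i i v i j = ∑ j ∈ Icc i n, A i j + (v - A i i) := by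
    have : ∀ j, upd A i i v i j = A i j + if j = i then v - A i i else 0 := by
      intro j
      by_cases h : j = i <;> simp [upd, h]
    simp [this, sum_add_distrib, hin]
  simp only [phi, if_true, h1, h2]
  ring

lemma InB.nonneg {n i m : ℕ} {A : Arr} (hA : InB n i m A) (p q : ℕ) : 0 ≤ A p q := by
  by_cases h : 1 ≤ p ∧ p ≤ i ∧ i ≤ q ∧ q ≤ n
  · exact hA.1 p q h.1 h.2.1 h.2.2.1 h.2.2.2
  · exact (hA.2.1 p q h).ge

/-- For `A, A' ∈ B^{m,i}` and `l ∈ {1,…,n}`: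
`f_l A = A'` if and only if `e_l A' = A`. -/
theorem stmt5 (n i m : ℕ) (hi : 1 ≤ i) (hin : i ≤ n) (A A' : Arr)
    (hA : InB n i m A) (hA' : InB n i m A') (l : ℕ) (hl : l ∈ Finset.Icc 1 n) :
    fop n i m l A = some A' ↔ eop n i m l A' = some A := by
  clear hl
  rcases lt_trichotomy l i with hli | rfl | hli
  · have hne : l ≠ i := hli.ne
    have hn : ¬ i < l := hli.not_gt
    simp only [fop, eop, hne, hn, if_false, Option.ite_none_left_eq_some, Option.some.injEq]
    constructor
    · rintro ⟨-, rfl⟩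
      set p := pminus n i A l with hp
      set A' := upd (upd A l p (A l p + 1)) (l + 1) p (A (l + 1) p - 1) with hA'def
      obtain ⟨h1, h2⟩ := sInf_maximizers_Gc (p := p) (x := A' l) (y := A' (l + 1)) (x' := A l)
        (y' := A (l + 1)) hi hin (fun j _ => hA.nonneg _ _) hp.symm
        (fun j => by by_cases h : j = p <;> simp [hA'def, upd, h])
        (fun j => by by_cases h : j = p <;> simp [hA'def, upd, h])
      have hq : qminus n i A' l = p := h1
      refine ⟨by simpa [eps, hne, hn, hq] using h2, ?_⟩
      rw [hq]
      funext a b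
      simp only [hA'def, upd]
      split_ifs <;> grind
    · rintro ⟨-, rfl⟩
      set p := qminus n i A' l with hp
      set A := upd (upd A' l p (A' l p - 1)) (l + 1) p (A' (l + 1) p + 1) with hAdef
      obtain ⟨h1, h2⟩ := sSup_maximizers_Gc (p := p) (x := A' l) (y := A' (l + 1)) (x' := A l)
        (y' := A (l + 1)) hin (fun j _ => hA'.nonneg _ _) hp.symm
        (fun j => by by_cases h : j = p <;> simp [hAdef, upd, h])
        (fun j => by by_cases h : j = p <;> simp [hAdef, upd, h])
      have hq : pminus n i A l = p := h1
      refine ⟨by simpa [phi, hne, hn, hq] using h2, ?_⟩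
      rw [hq]
      funext a b
      simp only [hAdef, upd]
      split_ifs <;> grind
  · simp only [fop, eop, if_true, Option.ite_none_left_eq_some, Option.some.injEq]
    constructor
    · rintro ⟨-, rfl⟩
      have := hA.nonneg l l
      refine ⟨by simp [eps, upd]; omega, ?_⟩
      funext a b
      simp only [upd]
      split_ifs <;> grind
    · rintro ⟨-, rfl⟩
      have := hA'.phi_self_nonneg hi hin
      refine ⟨by rw [phi_self_upd A' hi hin]; omega, ?_⟩
      funext a b
      simp only [upd]
      split_ifs <;> grind
  · have hne : l ≠ i := hli.ne'
    have hll : l - 1 ≠ l := by omega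
    simp only [fop, eop, hne, hli, if_false, if_true, Option.ite_none_left_eq_some,
      Option.some.injEq]
    constructor
    · rintro ⟨-, rfl⟩
      set p := pplus i A l with hp
      set A' := upd (upd A p (l - 1) (A p (l - 1) - 1)) p l (A p l + 1) with hA'def
      obtain ⟨h1, h2⟩ := sSup_maximizers_Gc (p := p) (x := fun j => A j (l - 1))
        (y := fun j => A j l) (x' := fun j => A' j (l - 1)) (y' := fun j => A' j l) hi
        (fun j _ => hA.nonneg _ _) hp.symm
        (fun j => by by_cases h : j = p <;> simp [hA'def, upd, h, hll])
        (fun j => by by_cases h : j = p <;> simp [hA'def, upd, h])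
      have hq : qplus i A' l = p := h1
      refine ⟨by simpa [eps, hne, hli, hq] using h2, ?_⟩
      rw [hq]
      funext a b
      simp only [hA'def, upd]
      split_ifs <;> grind
    · rintro ⟨-, rfl⟩
      set p := qplus i A' l with hp
      set A := upd (upd A' p (l - 1) (A' p (l - 1) + 1)) p l (A' p l - 1) with hAdef
      obtain ⟨h1, h2⟩ := sInf_maximizers_Gc (p := p) (x := fun j => A j (l - 1))
        (y := fun j => A j l) (x' := fun j => A' j (l - 1)) (y' := fun j => A' j l) le_rfl hi
        (fun j _ => hA'.nonneg _ _) hp.symm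
        (fun j => by by_cases h : j = p <;> simp [hAdef, upd, h, hll])
        (fun j => by by_cases h : j = p <;> simp [hAdef, upd, h])
      have hq : pplus i A l = p := h1
      refine ⟨by simpa [phi, hne, hli, hq] using h2, ?_⟩
      rw [hq]
      funext a b
      simp only [hAdef, upd]
      split_ifs <;> grind

end KR
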